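/- arXiv:2604.15393 — 2 statements merged into one kernel-verified Lean document; each statement's English description precedes it below -/
import Mathlib

section
/- Belief-space discretization error bound for an arbitrary belief state: assume each exact value function V_t is L_t-Lipschitz on Δ_M with respect to ‖·‖_∞, and define the projected estimator Ṽ_t(b) := V̂_t(Proj_B(b)) for b ∈ Δ_M. Then for every t = 0,…,H and every b ∈ Δ_M, |V_t(b) − Ṽ_t(b)| ≤ δ_B · Σ_{s=t}^{H} L_s. -/
open Finset ComplexOrder

/-- The belief simplex `Δ_M ⊆ ℝ^M`. -/
def simplex (M : ℕ) : Set (Fin M → ℝ) :=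
  {b | (∀ i, 0 ≤ b i) ∧ ∑ i, b i = 1}

/-- The real number `Re Tr(E ρ)`, the Born-rule likelihood value. -/
noncomputable def trRe {d : ℕ} (E ρ : Matrix (Fin d) (Fin d) ℂ) : ℝ :=
  ((E * ρ).trace).re

/-- Observation probability `ObsProb(o | b, a) = Σ_j b j · Tr(E_o^{(a)} ρ_j)`. -/
noncomputable def obsProb {d M : ℕ} {O A : Type}
    (E : A → O → Matrix (Fin d) (Fin d) ℂ)
    (ρ : Fin M → Matrix (Fin d) (Fin d) ℂ)
    (o : O) (b : Fin M → ℝ) (a : A) : ℝ :=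
  ∑ j, b j * trRe (E a o) (ρ j)

/-- Bayesian posterior `τ(b,a,o)(i) = b i · Tr(E_o^{(a)} ρ_i) / ObsProb(o|b,a)`
(junk value when `ObsProb(o|b,a) = 0`, which only ever appears multiplied by a zero
observation probability). -/
noncomputable def bayes {d M : ℕ} {O A : Type}
    (E : A → O → Matrix (Fin d) (Fin d) ℂ)
    (ρ : Fin M → Matrix (Fin d) (Fin d) ℂ)
    (b : Fin M → ℝ) (a : A) (o : O) : Fin M → ℝ :=
  fun i => b i * trRe (E a o) (ρ i) / obsProb E ρ o b a

/-- Stopping value `StopVal(b) = max_i b i`. -/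
noncomputable def stopVal {M : ℕ} [NeZero M] (b : Fin M → ℝ) : ℝ :=
  univ.sup' univ_nonempty b

open scoped MatrixOrder Matrix.Norms.L2Operator in
/-- The Born-rule likelihood of positive semidefinite matrices is nonnegative. -/
lemma trRe_nonneg {d : ℕ} {E ρ : Matrix (Fin d) (Fin d) ℂ}
    (hE : E.PosSemidef) (hρ : ρ.PosSemidef) : 0 ≤ trRe E ρ := by
  obtain ⟨C, rfl⟩ := CStarAlgebra.nonneg_iff_eq_star_mul_self.mp hE.nonneg
  have h := (hρ.mul_mul_conjTranspose_same C).trace_nonneg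
  rw [Matrix.trace_mul_cycle] at h
  exact (Complex.nonneg_iff.mp h).1

lemma sum_trRe {d : ℕ} {O : Type} [Fintype O] (E : O → Matrix (Fin d) (Fin d) ℂ)
    (ρ : Matrix (Fin d) (Fin d) ℂ) : ∑ o, trRe (E o) ρ = trRe (∑ o, E o) ρ := by
  simp only [trRe, Finset.sum_mul, Matrix.trace_sum, Complex.re_sum]

section ObsProb

variable {d M : ℕ} {O A : Type} {E : A → O → Matrix (Fin d) (Fin d) ℂ}
  {ρ : Fin M → Matrix (Fin d) (Fin d) ℂ} {b : Fin M → ℝ}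

lemma obsProb_nonneg (hE : ∀ a o, (E a o).PosSemidef) (hρ : ∀ i, (ρ i).PosSemidef)
    (hb : b ∈ simplex M) (a : A) (o : O) : 0 ≤ obsProb E ρ o b a :=
  Finset.sum_nonneg fun j _ => mul_nonneg (hb.1 j) (trRe_nonneg (hE a o) (hρ j))

lemma sum_obsProb [Fintype O] (hρ : ∀ i, (ρ i).trace = 1) (hE : ∀ a, ∑ o, E a o = 1)
    (hb : b ∈ simplex M) (a : A) : ∑ o, obsProb E ρ o b a = 1 := by
  simp only [obsProb]
  rw [Finset.sum_comm]
  simp only [← Finset.mul_sum, sum_trRe, hE]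
  simp [trRe, hρ, hb.2]

lemma bayes_mem_simplex (hE : ∀ a o, (E a o).PosSemidef) (hρ : ∀ i, (ρ i).PosSemidef)
    (hb : b ∈ simplex M) {a : A} {o : O} (h : obsProb E ρ o b a ≠ 0) :
    bayes E ρ b a o ∈ simplex M := by
  refine ⟨fun i => div_nonneg (mul_nonneg (hb.1 i) (trRe_nonneg (hE a o) (hρ i)))
    (obsProb_nonneg hE hρ hb a o), ?_⟩
  simp only [bayes, ← Finset.sum_div]
  exact div_self h

end ObsProb

/-- Taking the maximum of a nonempty finite family is nonexpansive. -/
lemma abs_sup'_sub_sup'_le {ι : Type*} {s : Finset ι} (hs : s.Nonempty) {f g : ι → ℝ} {ε : ℝ}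
    (h : ∀ i ∈ s, |f i - g i| ≤ ε) : |s.sup' hs f - s.sup' hs g| ≤ ε := by
  have hle : ∀ u v : ι → ℝ, (∀ i ∈ s, u i ≤ v i + ε) → s.sup' hs u ≤ s.sup' hs v + ε :=
    fun u v huv => Finset.sup'_le hs u fun i hi =>
      (huv i hi).trans (by gcongr; exact Finset.le_sup' v hi)
  have h₁ := hle f g fun i hi => by linarith [(abs_le.mp (h i hi)).2]
  have h₂ := hle g f fun i hi => by linarith [(abs_le.mp (h i hi)).1]
  exact abs_le.mpr ⟨by linarith, by linarith⟩

/-- Weighted averages of functions that are `ε`-close wherever the weight is nonzero are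
`ε`-close. -/
lemma abs_sum_mul_sub_sum_mul_le {ι : Type*} [Fintype ι] {p f g : ι → ℝ} {ε : ℝ}
    (hp : ∀ i, 0 ≤ p i) (hsum : ∑ i, p i = 1) (h : ∀ i, p i ≠ 0 → |f i - g i| ≤ ε) :
    |∑ i, p i * f i - ∑ i, p i * g i| ≤ ε := by
  rw [← Finset.sum_sub_distrib]
  calc |∑ i, (p i * f i - p i * g i)| ≤ ∑ i, |p i * f i - p i * g i| :=
        Finset.abs_sum_le_sum_abs _ _
    _ ≤ ∑ i, p i * ε := Finset.sum_le_sum fun i _ => by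
        rw [← mul_sub, abs_mul, abs_of_nonneg (hp i)]
        by_cases hi : p i = 0
        · simp [hi]
        · exact mul_le_mul_of_nonneg_left (h i hi) (hp i)
    _ = ε := by rw [← Finset.sum_mul, hsum, one_mul]

/-- Belief-space discretization error bound for an arbitrary belief state: with the
projected estimator `Ṽ_t(b) := V̂_t(Proj_B(b))`, for every `t = 0,…,H` and every
`b ∈ Δ_M`, `|V_t(b) − Ṽ_t(b)| ≤ δ_B · Σ_{s=t}^{H} L_s`. -/
theorem belief_discretization_error_arbitrary
    (d M : ℕ) (hd : 0 < d) [NeZero M]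
    (O A : Type) [Fintype O] [Nonempty O] [Fintype A] [Nonempty A]
    (ρ : Fin M → Matrix (Fin d) (Fin d) ℂ)
    (hρpsd : ∀ i, (ρ i).PosSemidef) (hρtr : ∀ i, (ρ i).trace = 1)
    (E : A → O → Matrix (Fin d) (Fin d) ℂ)
    (hEpsd : ∀ a o, (E a o).PosSemidef) (hEsum : ∀ a, ∑ o, E a o = 1)
    (H : ℕ) (c : ℝ)
    (B : Finset (Fin M → ℝ)) (hBne : B.Nonempty) (hBsub : ∀ x ∈ B, x ∈ simplex M)
    (proj : (Fin M → ℝ) → (Fin M → ℝ)) (hproj : ∀ x ∈ simplex M, proj x ∈ B)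
    (δB : ℝ) (hδB : ∀ x ∈ simplex M, ‖x - proj x‖ ≤ δB)
    (V : ℕ → (Fin M → ℝ) → ℝ)
    (hVH : ∀ b ∈ simplex M, V H b = stopVal b)
    (hVrec : ∀ t < H, ∀ b ∈ simplex M,
      V t b = max (stopVal b)
        (univ.sup' univ_nonempty fun a =>
          -c + ∑ o, obsProb E ρ o b a * V (t + 1) (bayes E ρ b a o)))
    (Vhat : ℕ → (Fin M → ℝ) → ℝ)
    (hVhatH : ∀ b ∈ B, Vhat H b = stopVal b)
    (hVhatrec : ∀ t < H, ∀ b ∈ B,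
      Vhat t b = max (stopVal b)
        (univ.sup' univ_nonempty fun a =>
          -c + ∑ o, obsProb E ρ o b a * Vhat (t + 1) (proj (bayes E ρ b a o))))
    (L : ℕ → ℝ) (hL0 : ∀ t, 0 ≤ L t)
    (hLip : ∀ t ≤ H, ∀ b ∈ simplex M, ∀ b' ∈ simplex M,
      |V t b - V t b'| ≤ L t * ‖b - b'‖) :
    ∀ t ≤ H, ∀ b ∈ simplex M,
      |V t b - Vhat t (proj b)| ≤ δB * ∑ s ∈ Finset.Icc t H, L s := by
  have lipschitz_proj : ∀ t ≤ H, ∀ b ∈ simplex M, |V t b - V t (proj b)| ≤ δB * L t :=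
    fun t ht b hb => (hLip t ht b hb _ (hBsub _ (hproj b hb))).trans <| by
      rw [mul_comm]
      exact mul_le_mul_of_nonneg_right (hδB b hb) (hL0 t)
  intro t ht
  induction ht using Nat.decreasingInduction with
  | self =>
    intro b hb
    have hpb := hproj b hb
    have h := lipschitz_proj H le_rfl b hb
    rw [hVH _ (hBsub _ hpb), ← hVhatH _ hpb] at h
    simpa using h
  | of_succ t ht ih =>
    intro b hb
    have hpb := hproj b hb
    have hps := hBsub _ hpb
    have hgrid : |V t (proj b) - Vhat t (proj b)| ≤ δB * ∑ s ∈ Finset.Icc (t + 1) H, L s := by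
      rw [hVrec t ht _ hps, hVhatrec t ht _ hpb, max_comm (stopVal _), max_comm (stopVal _)]
      refine (abs_max_sub_max_le_abs _ _ _).trans (abs_sup'_sub_sup'_le _ fun a _ => ?_)
      rw [add_sub_add_left_eq_sub]
      exact abs_sum_mul_sub_sum_mul_le (obsProb_nonneg hEpsd hρpsd hps a)
        (sum_obsProb hρtr hEsum hps a)
        fun o ho => ih _ (bayes_mem_simplex hEpsd hρpsd hps ho)
    rw [← Finset.add_sum_Ioc_eq_sum_Icc ht.le, ← Finset.Icc_add_one_left_eq_Ioc, mul_add]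
    exact (abs_sub_le _ _ _).trans (add_le_add (lipschitz_proj t ht.le b hb) hgrid)
end

section
/- Lipschitz continuity of the Bayesian posterior in the action variable: suppose there is a constant L_ℓ ≥ 0 such that |ℓ_i(θ,o) − ℓ_i(θ',o)| ≤ L_ℓ·d_Θ(θ,θ') for all i, o, θ, θ', and a constant η > 0 such that ObsProb(o|b,θ) ≥ η for all b ∈ Δ_M, θ ∈ Θ, o ∈ O. Then for every fixed b ∈ Δ_M and o ∈ O and all θ,θ' ∈ Θ, ‖τ(b,θ,o) − τ(b,θ',o)‖_∞ ≤ ( L_ℓ/η + L_ℓ/η² )·d_Θ(θ,θ'). -/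
open Finset ComplexOrder

/-- Continuation functional
`G(b,θ;W) = −c_meas + Σ_o ObsProb(o|b,θ) · W(τ(b,θ,o))`
(outcomes with `ObsProb(o|b,θ) = 0` contribute zero). -/
noncomputable def contG {d M : ℕ} {O Θ : Type} [Fintype O]
    (E : Θ → O → Matrix (Fin d) (Fin d) ℂ)
    (ρ : Fin M → Matrix (Fin d) (Fin d) ℂ)
    (c : ℝ) (b : Fin M → ℝ) (θ : Θ) (W : (Fin M → ℝ) → ℝ) : ℝ :=
  -c + ∑ o, obsProb E ρ o b θ * W (bayes E ρ b θ o)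

/-- If both denominators are at least `η > 0`, the second numerator lies in `[-1, 1]`, and
numerators and denominators differ by at most `δ`, then the quotients differ by at most
`δ / η + δ / η ^ 2`. -/
theorem abs_div_sub_div_le {p p' P P' δ η : ℝ} (hη : 0 < η) (hP : η ≤ P) (hP' : η ≤ P')
    (hp' : |p'| ≤ 1) (hp : |p - p'| ≤ δ) (hPP' : |P - P'| ≤ δ) :
    |p / P - p' / P'| ≤ δ / η + δ / η ^ 2 := by
  have hP0 : 0 < P := hη.trans_le hP
  have hP0' : 0 < P' := hη.trans_le hP'
  have hδ : 0 ≤ δ := (abs_nonneg _).trans hp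
  have hsplit : p / P - p' / P' = (p - p') / P + p' * (P' - P) / (P * P') := by
    field_simp
    ring
  rw [hsplit]
  refine (abs_add_le _ _).trans (add_le_add ?_ ?_)
  · rw [abs_div, abs_of_pos hP0]
    exact div_le_div₀ hδ hp hη hP
  · rw [abs_div, abs_of_pos (mul_pos hP0 hP0'), abs_mul, abs_sub_comm P' P]
    refine div_le_div₀ hδ ?_ (by positivity) ?_
    · simpa using mul_le_mul hp' hPP' (abs_nonneg _) zero_le_one
    · rw [pow_two]
      exact mul_le_mul hP hP' hη.le hP0.le

/-- The Born-rule likelihoods of a state of trace one sum to one over the outcomes. -/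
theorem sum_trRe_eq_one {d : ℕ} {O : Type} [Fintype O] {E : O → Matrix (Fin d) (Fin d) ℂ}
    {ρ : Matrix (Fin d) (Fin d) ℂ} (hE : ∑ o, E o = 1) (hρ : ρ.trace = 1) :
    ∑ o, trRe (E o) ρ = 1 := by
  simp only [trRe]
  rw [← Complex.re_sum, ← Matrix.trace_sum, ← Finset.sum_mul, hE, one_mul, hρ, Complex.one_re]

/-- The standard basis vectors belong to the belief simplex. -/
theorem single_mem_simplex {M : ℕ} (i : Fin M) : Pi.single i (1 : ℝ) ∈ simplex M :=
  ⟨fun j => (Pi.single_nonneg.2 zero_le_one : (0 : Fin M → ℝ) ≤ Pi.single i 1) j, by simp⟩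

/-- At a vertex of the simplex the observation probability is the corresponding likelihood. -/
theorem obsProb_single {d M : ℕ} {O A : Type} (E : A → O → Matrix (Fin d) (Fin d) ℂ)
    (ρ : Fin M → Matrix (Fin d) (Fin d) ℂ) (o : O) (i : Fin M) (a : A) :
    obsProb E ρ o (Pi.single i 1) a = trRe (E a o) (ρ i) := by
  simp [obsProb, Pi.single_apply]

/-- The observation probability is as Lipschitz in the action as the likelihoods are. -/
theorem abs_obsProb_sub_le {d M : ℕ} {O A : Type} {E : A → O → Matrix (Fin d) (Fin d) ℂ}
    {ρ : Fin M → Matrix (Fin d) (Fin d) ℂ} {o : O} {b : Fin M → ℝ} (hb : b ∈ simplex M)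
    {a a' : A} {δ : ℝ} (h : ∀ i, |trRe (E a o) (ρ i) - trRe (E a' o) (ρ i)| ≤ δ) :
    |obsProb E ρ o b a - obsProb E ρ o b a'| ≤ δ := by
  calc |obsProb E ρ o b a - obsProb E ρ o b a'|
      = |∑ i, b i * (trRe (E a o) (ρ i) - trRe (E a' o) (ρ i))| := by
        simp only [obsProb, mul_sub, Finset.sum_sub_distrib]
    _ ≤ ∑ i, |b i * (trRe (E a o) (ρ i) - trRe (E a' o) (ρ i))| :=
        Finset.abs_sum_le_sum_abs _ _
    _ ≤ ∑ i, b i * δ := by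
        refine Finset.sum_le_sum fun i _ => ?_
        rw [abs_mul, abs_of_nonneg (hb.1 i)]
        exact mul_le_mul_of_nonneg_left (h i) (hb.1 i)
    _ = δ := by rw [← Finset.sum_mul, hb.2, one_mul]

/-- Lipschitz continuity of the Bayesian posterior in the action variable: if each
likelihood is `L_ℓ`-Lipschitz in `θ` and `ObsProb(o|b,θ) ≥ η > 0` on the simplex, then
for every `b ∈ Δ_M`, `o ∈ O`, and all `θ, θ'`,
`‖τ(b,θ,o) − τ(b,θ',o)‖_∞ ≤ (L_ℓ/η + L_ℓ/η²) · d_Θ(θ,θ')`. -/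
theorem posterior_action_lipschitz
    (d M : ℕ) (hd : 0 < d) [NeZero M]
    (O : Type) [Fintype O] [Nonempty O]
    (Θ : Type) [MetricSpace Θ]
    (ρ : Fin M → Matrix (Fin d) (Fin d) ℂ)
    (hρpsd : ∀ i, (ρ i).PosSemidef) (hρtr : ∀ i, (ρ i).trace = 1)
    (E : Θ → O → Matrix (Fin d) (Fin d) ℂ)
    (hEpsd : ∀ θ o, (E θ o).PosSemidef) (hEsum : ∀ θ, ∑ o, E θ o = 1)
    (Lℓ : ℝ) (hLℓ : 0 ≤ Lℓ)
    (hLik : ∀ (i : Fin M) (o : O) (θ θ' : Θ),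
      |trRe (E θ o) (ρ i) - trRe (E θ' o) (ρ i)| ≤ Lℓ * dist θ θ')
    (η : ℝ) (hη : 0 < η)
    (hηlb : ∀ b ∈ simplex M, ∀ (θ : Θ) (o : O), η ≤ obsProb E ρ o b θ) :
    ∀ b ∈ simplex M, ∀ (o : O) (θ θ' : Θ),
      ‖bayes E ρ b θ o - bayes E ρ b θ' o‖ ≤ (Lℓ / η + Lℓ / η ^ 2) * dist θ θ' := by
  intro b hb o θ θ'
  have hLik_pos : ∀ i o, 0 ≤ trRe (E θ' o) (ρ i) := fun i o =>
    obsProb_single E ρ o i θ' ▸ hη.le.trans (hηlb _ (single_mem_simplex i) θ' o)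
  have hLik_le : ∀ i, trRe (E θ' o) (ρ i) ≤ 1 := fun i =>
    (Finset.single_le_sum (fun o _ => hLik_pos i o) (Finset.mem_univ o)).trans_eq
      (sum_trRe_eq_one (hEsum θ') (hρtr i))
  have hb_le : ∀ i, b i ≤ 1 := fun i =>
    (Finset.single_le_sum (fun j _ => hb.1 j) (Finset.mem_univ i)).trans_eq hb.2
  have hδ : 0 ≤ Lℓ * dist θ θ' := mul_nonneg hLℓ dist_nonneg
  refine (pi_norm_le_iff_of_nonneg (by positivity)).2 fun i => ?_
  rw [Real.norm_eq_abs, add_mul, div_mul_eq_mul_div, div_mul_eq_mul_div]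
  refine abs_div_sub_div_le hη (hηlb b hb θ o) (hηlb b hb θ' o) ?_ ?_
    (abs_obsProb_sub_le hb fun i => hLik i o θ θ')
  · rw [abs_of_nonneg (mul_nonneg (hb.1 i) (hLik_pos i o))]
    exact mul_le_one₀ (hb_le i) (hLik_pos i o) (hLik_le i)
  · rw [← mul_sub, abs_mul, abs_of_nonneg (hb.1 i)]
    exact (mul_le_mul (hb_le i) (hLik i o θ θ') (abs_nonneg _) zero_le_one).trans_eq (one_mul _)
end
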